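/- arXiv:math/0508032 — 8 statements merged into one kernel-verified Lean document; each statement's English description precedes it below -/
import Mathlib

section
/- (p-adic Liouville inequality for algebraic numbers.) Let p be a prime and let α ∈ ℂ_p satisfy ‖α‖ ≤ 1, be algebraic over ℚ of degree k (i.e., k is the degree of the minimal polynomial of α over ℚ), and suppose α is not equal to the image of any natural number in ℂ_p. Then there exists a real constant C' > 0 such that for every natural number n ≥ 1, ‖α − n‖ ≥ C' / n^k; equivalently, there is a constant C such that ord_p(α − n) ≤ C + k·log_p(n) for all n ≥ 1. -/
/-- `K` is (a copy of) the field `ℂ_p` of complex `p`-adic numbers: a complete,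
algebraically closed, ultrametrically normed field extension of `ℚ_[p]` whose norm
extends the `p`-adic norm isometrically and in which the algebraic closure of
`ℚ_[p]` (its integral closure in `K`) is dense.  These properties characterize
`ℂ_p` up to isometric isomorphism. -/
class IsPadicComplex (p : ℕ) [Fact p.Prime] (K : Type*) [NontriviallyNormedField K]
    [Algebra ℚ_[p] K] : Prop where
  complete : CompleteSpace K
  isAlgClosed : IsAlgClosed K
  ultrametric : IsUltrametricDist K
  isometry_algebraMap : Isometry (algebraMap ℚ_[p] K)
  denseRange_algebraic : DenseRange ((↑) : integralClosure ℚ_[p] K → K)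

open Polynomial

/-- A nonzero integer `m` satisfies `|m|⁻¹ ≤ ‖m‖` in `ℚ_[p]`. -/
theorem Padic.inv_abs_le_norm_intCast (p : ℕ) [Fact p.Prime] {m : ℤ} (hm : m ≠ 0) :
    (|m| : ℝ)⁻¹ ≤ ‖(m : ℚ_[p])‖ := by
  have hp : (0 : ℝ) < p := mod_cast (Fact.out : p.Prime).pos
  rw [Padic.norm_eq_zpow_neg_valuation (Int.cast_ne_zero.mpr hm), Padic.valuation_intCast,
    zpow_neg, zpow_natCast]
  have hle : (p : ℤ) ^ padicValInt p m ≤ |m| :=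
    Int.le_of_dvd (abs_pos.mpr hm) ((dvd_abs _ _).mpr (padicValInt_dvd m))
  exact inv_anti₀ (by positivity) (mod_cast hle)

/-- Integer polynomials are `1`-Lipschitz on the unit ball of an ultrametric field. -/
theorem norm_aeval_sub_aeval_le {K : Type*} [NormedField K] [IsUltrametricDist K] (P : ℤ[X])
    {x y : K} (hx : ‖x‖ ≤ 1) (hy : ‖y‖ ≤ 1) : ‖aeval x P - aeval y P‖ ≤ ‖x - y‖ := by
  let O := (NormedField.valuation (K := K)).integer
  let a : O := ⟨x, hx⟩
  let b : O := ⟨y, hy⟩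
  obtain ⟨⟨c, hc⟩, h⟩ := sub_dvd_eval_sub a b (P.map (Int.castRingHom O))
  have hcoe (z : O) : ((eval z (P.map (Int.castRingHom O)) : O) : K) = aeval (z : K) P := by
    rw [eval_map, ← O.subtype_apply, hom_eval₂, aeval_def]
    congr 1
  have hxy : aeval x P - aeval y P = (x - y) * c := by
    rw [← hcoe a, ← hcoe b]
    exact congrArg Subtype.val h
  rw [hxy, norm_mul]
  exact mul_le_of_le_one_right (norm_nonneg _) hc

/-- The value of an integer polynomial at `n ≥ 1` is at most the sum of the absolute values of
its coefficients times `n` to its degree. -/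
theorem Polynomial.abs_eval_natCast_le (P : ℤ[X]) {n : ℕ} (hn : 1 ≤ n) :
    |P.eval (n : ℤ)| ≤
      (∑ i ∈ Finset.range (P.natDegree + 1), |P.coeff i|) * (n : ℤ) ^ P.natDegree := by
  rw [eval_eq_sum_range, Finset.sum_mul]
  refine (Finset.abs_sum_le_sum_abs _ _).trans (Finset.sum_le_sum fun i hi => ?_)
  rw [abs_mul, abs_of_nonneg (by positivity : (0 : ℤ) ≤ (n : ℤ) ^ i)]
  have hi' : i ≤ P.natDegree := Nat.lt_succ_iff.mp (Finset.mem_range.mp hi)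
  have hn' : (1 : ℤ) ≤ n := mod_cast hn
  gcongr

/-- A rational polynomial has a nonzero integer multiple with integer coefficients. -/
theorem Polynomial.exists_int_map_eq_C_mul (f : ℚ[X]) :
    ∃ (b : ℚ) (P : ℤ[X]), b ≠ 0 ∧ P.map (algebraMap ℤ ℚ) = C b * f := by
  obtain ⟨b, hb, h⟩ := IsLocalization.integerNormalization_spec (nonZeroDivisors ℤ) f
  refine ⟨b, _, Int.cast_ne_zero.mpr (nonZeroDivisors.ne_zero hb), h.trans ?_⟩
  rw [← smul_eq_C_mul, Int.cast_smul_eq_zsmul]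

/-- `p`-adic Liouville inequality: an algebraic `α ∈ ℂ_p` of degree `k` with
`‖α‖ ≤ 1` which is not a natural number satisfies `‖α - n‖ ≥ C' / nᵏ`. -/
theorem padic_liouville_inequality (p : ℕ) [Fact p.Prime] (K : Type*)
    [NontriviallyNormedField K] [Algebra ℚ_[p] K] [IsPadicComplex p K] [CharZero K]
    (α : K) (hα : ‖α‖ ≤ 1) (halg : IsAlgebraic ℚ α)
    (k : ℕ) (hk : (minpoly ℚ α).natDegree = k)
    (hnat : ∀ n : ℕ, α ≠ (n : K)) :
    ∃ C' : ℝ, 0 < C' ∧ ∀ n : ℕ, 1 ≤ n → C' / (n : ℝ) ^ k ≤ ‖α - (n : K)‖ := by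
  have : IsUltrametricDist K := IsPadicComplex.ultrametric p
  have hnorm (m : ℤ) : ‖(m : K)‖ = ‖(m : ℚ_[p])‖ := by
    rw [← map_intCast (algebraMap ℚ_[p] K),
      (IsPadicComplex.isometry_algebraMap (p := p) (K := K)).norm_map_of_map_zero (map_zero _)]
  obtain ⟨b, P, hb, hP⟩ := exists_int_map_eq_C_mul (minpoly ℚ α)
  have hdeg : P.natDegree = k := by
    rw [← hk, ← natDegree_C_mul hb, ← hP, natDegree_map_eq_of_injective Int.cast_injective]
  have hPα : aeval α P = 0 := by
    rw [← aeval_map_algebraMap ℚ, hP, map_mul, minpoly.aeval, mul_zero]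
  have hPn (n : ℕ) : P.eval (n : ℤ) ≠ 0 := by
    intro h
    have h' : (P.map (algebraMap ℤ ℚ)).eval (n : ℚ) = 0 := by
      simp [h]
    rw [hP, eval_mul, eval_C, mul_eq_zero, or_iff_right hb] at h'
    exact hnat n (by simpa using (minpoly.root halg.isIntegral h').symm)
  have hbound (n : ℕ) (hn : 1 ≤ n) := abs_eval_natCast_le P hn
  set H : ℤ := ∑ i ∈ Finset.range (P.natDegree + 1), |P.coeff i|
  have hH : 0 < H := by
    have := (abs_pos.mpr (hPn 1)).trans_le (hbound 1 le_rfl)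
    simpa using this
  refine ⟨(H : ℝ)⁻¹, by positivity, fun n hn => ?_⟩
  have hn1 : ‖(n : K)‖ ≤ 1 := by
    simpa using (hnorm n).trans_le (Padic.norm_int_le_one _)
  have hle : |((P.eval (n : ℤ) : ℤ) : ℝ)| ≤ H * (n : ℝ) ^ k := by
    have := hbound n hn
    rw [hdeg] at this
    exact_mod_cast this
  have hpos : (0 : ℝ) < |((P.eval (n : ℤ) : ℤ) : ℝ)| := abs_pos.mpr (Int.cast_ne_zero.mpr (hPn n))
  have haeval : aeval (n : K) P = ((P.eval (n : ℤ) : ℤ) : K) := by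
    simpa using aeval_algebraMap_apply K (n : ℤ) P
  calc (H : ℝ)⁻¹ / (n : ℝ) ^ k = (H * (n : ℝ) ^ k)⁻¹ := by rw [mul_inv, div_eq_mul_inv]
    _ ≤ |((P.eval (n : ℤ) : ℤ) : ℝ)|⁻¹ := inv_anti₀ hpos hle
    _ ≤ ‖((P.eval (n : ℤ) : ℤ) : ℚ_[p])‖ := Padic.inv_abs_le_norm_intCast p (hPn n)
    _ = ‖aeval α P - aeval (n : K) P‖ := by rw [hPα, zero_sub, norm_neg, haeval, hnorm]
    _ ≤ ‖α - (n : K)‖ := norm_aeval_sub_aeval_le P hα hn1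
end

section
/- Let p be a prime and s a natural number. Then the averages (1/N) · Σ_{j ∈ {1,…,N}, v_p(j) ≤ s} v_p(j) converge, as N → ∞, to (1 − p^{−s})/(p − 1) − s/p^{s+1}, where v_p(j) denotes the p-adic valuation of the natural number j and the sum runs over those j ∈ {1,…,N} with v_p(j) ≤ s. -/
theorem tendsto_natCast_div_div_atTop (d : ℕ) :
    Filter.Tendsto (fun N : ℕ => ((N / d : ℕ) : ℝ) / N) Filter.atTop (nhds (d : ℝ)⁻¹) := by
  have h := (tendsto_nat_floor_mul_div_atTop (R := ℝ) (a := (d : ℝ)⁻¹) (by positivity)).comp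
    tendsto_natCast_atTop_atTop
  refine h.congr fun N => ?_
  simp only [Function.comp_apply]
  rw [← Nat.floor_div_eq_div (K := ℝ), div_eq_inv_mul (N : ℝ)]

theorem card_filter_le_padicValNat {p : ℕ} (hp : p.Prime) (N k : ℕ) :
    ((Finset.Icc 1 N).filter (fun j => k ≤ padicValNat p j)).card = N / p ^ k := by
  rw [← Nat.Ioc_filter_dvd_card_eq_div]
  congr 1
  ext j
  simp only [Finset.mem_filter, Finset.mem_Icc, Finset.mem_Ioc, Nat.succ_le_iff]
  refine and_congr_right fun hj => ?_
  rw [padicValNat_dvd_iff_le_of_ne_one hp.ne_one hj.1.ne']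

theorem card_filter_padicValNat_eq {p : ℕ} (hp : p.Prime) (N k : ℕ) :
    (((Finset.Icc 1 N).filter (fun j => padicValNat p j = k)).card : ℝ) =
      ((N / p ^ k : ℕ) : ℝ) - ((N / p ^ (k + 1) : ℕ) : ℝ) := by
  rw [← card_filter_le_padicValNat hp, ← card_filter_le_padicValNat hp, eq_sub_iff_add_eq]
  norm_cast
  rw [← Finset.card_union_of_disjoint, ← Finset.filter_or]
  · congr 1
    ext j
    simp only [Finset.mem_filter]
    refine and_congr_right fun _ => ?_
    omega
  · refine Finset.disjoint_filter.2 fun j _ h => ?_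
    omega

theorem tendsto_card_filter_padicValNat_eq_div {p : ℕ} (hp : p.Prime) (k : ℕ) :
    Filter.Tendsto
      (fun N : ℕ => (((Finset.Icc 1 N).filter (fun j => padicValNat p j = k)).card : ℝ) / N)
      Filter.atTop (nhds (((p : ℝ) ^ k)⁻¹ - ((p : ℝ) ^ (k + 1))⁻¹)) := by
  have h := (tendsto_natCast_div_div_atTop (p ^ k)).sub
    (tendsto_natCast_div_div_atTop (p ^ (k + 1)))
  push_cast at h
  refine h.congr fun N => ?_
  rw [card_filter_padicValNat_eq hp, sub_div]

theorem sum_filter_padicValNat_le_succ (p N s : ℕ) :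
    ∑ j ∈ (Finset.Icc 1 N).filter (fun j => padicValNat p j ≤ s + 1), (padicValNat p j : ℝ) =
      ∑ j ∈ (Finset.Icc 1 N).filter (fun j => padicValNat p j ≤ s), (padicValNat p j : ℝ) +
        ((Finset.Icc 1 N).filter (fun j => padicValNat p j = s + 1)).card * ((s : ℝ) + 1) := by
  simp only [Nat.le_succ_iff]
  rw [Finset.filter_or, Finset.sum_union]
  · congr 1
    rw [← nsmul_eq_mul]
    refine Finset.sum_eq_card_nsmul fun j hj => ?_
    rw [(Finset.mem_filter.1 hj).2]
    push_cast
    rfl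
  · refine Finset.disjoint_filter.2 fun j _ h => ?_
    omega

/-- The averages of the truncated `p`-adic valuations
`(1/N) ∑_{1 ≤ j ≤ N, v_p(j) ≤ s} v_p(j)` converge to
`(1 - p⁻ˢ)/(p - 1) - s/p^{s+1}`. -/
theorem average_truncated_padic_valuation (p : ℕ) (hp : p.Prime) (s : ℕ) :
    Filter.Tendsto
      (fun N : ℕ => (1 / (N : ℝ)) *
        ∑ j ∈ (Finset.Icc 1 N).filter (fun j => padicValNat p j ≤ s),
          (padicValNat p j : ℝ))
      Filter.atTop
      (nhds ((1 - (p : ℝ) ^ (-(s : ℤ))) / ((p : ℝ) - 1) - (s : ℝ) / (p : ℝ) ^ (s + 1))) := by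
  induction s with
  | zero =>
    have h (N : ℕ) : ∑ j ∈ (Finset.Icc 1 N).filter (fun j => padicValNat p j ≤ 0),
        (padicValNat p j : ℝ) = 0 :=
      Finset.sum_eq_zero fun j hj => by
        rw [Nat.le_zero.1 (Finset.mem_filter.1 hj).2, Nat.cast_zero]
    simp only [h]
    simp
  | succ s ih =>
    have hp0 : (p : ℝ) ≠ 0 := by exact_mod_cast hp.ne_zero
    have hp1 : (p : ℝ) - 1 ≠ 0 := sub_ne_zero.2 (by exact_mod_cast hp.ne_one)
    convert ih.add ((tendsto_card_filter_padicValNat_eq_div hp (s + 1)).mul_const ((s : ℝ) + 1))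
      using 2 with N
    · rw [sum_filter_padicValNat_le_succ]
      ring
    · simp only [zpow_neg, zpow_natCast]
      push_cast
      field_simp
      ring
end

section
/- (Clark's lemma, integral case.) Let p be a prime and let α ∈ ℤ_p be a p-adic integer such that α, viewed as an element of ℚ_p, is algebraic over ℚ. Then there exists a natural number m such that α ≠ i for every natural number i ≥ m and the averages (1/N) · Σ_{i=m}^{N} ord_p(α − i) converge, as N → ∞, to 1/(p − 1). -/
/-- The additive `p`-adic valuation `ord_p x = -log ‖x‖ / log p`. -/
noncomputable def ordp (p : ℕ) {L : Type*} [NormedField L] (x : L) : ℝ :=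
  -Real.log ‖x‖ / Real.log p

open Filter Topology Polynomial

theorem ordp_coe_padicInt {p : ℕ} [Fact p.Prime] {x : ℤ_[p]} (hx : x ≠ 0) :
    ordp p (x : ℚ_[p]) = x.valuation := by
  have hlog : Real.log p ≠ 0 :=
    (Real.log_pos (by exact_mod_cast (Fact.out : p.Prime).one_lt)).ne'
  rw [ordp, PadicInt.padic_norm_e_of_padicInt, PadicInt.norm_eq_zpow_neg_valuation hx,
    Real.log_zpow]
  push_cast
  field_simp

theorem PadicInt.le_valuation_sub_natCast_iff {p : ℕ} [Fact p.Prime] {α : ℤ_[p]} {i : ℕ}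
    (hi : α - i ≠ 0) (k : ℕ) :
    k ≤ (α - i).valuation ↔ i ≡ α.appr k [MOD p ^ k] := by
  have happr := Ideal.mem_span_singleton.mp (PadicInt.appr_spec k α)
  rw [← PadicInt.mem_span_pow_iff_le_valuation _ hi, Ideal.mem_span_singleton,
    Nat.modEq_iff_dvd]
  have hcast : α - i = (α - α.appr k) + (((α.appr k : ℤ) - (i : ℤ) : ℤ) : ℤ_[p]) := by
    push_cast
    ring
  rw [hcast, dvd_add_right happr, PadicInt.pow_p_dvd_int_iff]
  push_cast
  rfl

theorem Nat.abs_card_Ico_filter_modEq_sub_le {a b r : ℕ} (hab : a ≤ b) (hr : 0 < r) (v : ℕ) :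
    |(((Finset.Ico a b).filter (· ≡ v [MOD r])).card : ℝ) - ((b : ℝ) - a) / r| ≤ 1 := by
  have hcard := Nat.Ico_filter_modEq_card a b hr v
  have hle : ((a : ℚ) - v) / r ≤ ((b : ℚ) - v) / r := by gcongr
  rw [max_eq_left (sub_nonneg.mpr (Int.ceil_mono hle))] at hcard
  have hcardQ : (((Finset.Ico a b).filter (· ≡ v [MOD r])).card : ℚ)
      = ⌈((b : ℚ) - v) / r⌉ - ⌈((a : ℚ) - v) / r⌉ := by exact_mod_cast hcard
  have hdiff : ((b : ℚ) - a) / r = ((b : ℚ) - v) / r - ((a : ℚ) - v) / r := by ring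
  have hQ : |(((Finset.Ico a b).filter (· ≡ v [MOD r])).card : ℚ) - ((b : ℚ) - a) / r| ≤ 1 := by
    rw [hcardQ, hdiff, abs_le]
    have hb := Int.ceil_lt_add_one (((b : ℚ) - v) / r)
    have hb' := Int.le_ceil (((b : ℚ) - v) / r)
    have ha := Int.ceil_lt_add_one (((a : ℚ) - v) / r)
    have ha' := Int.le_ceil (((a : ℚ) - v) / r)
    constructor <;> linarith
  have hR : ((|(((Finset.Ico a b).filter (· ≡ v [MOD r])).card : ℚ) - ((b : ℚ) - a) / r| : ℚ) : ℝ)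
      ≤ (1 : ℚ) := Rat.cast_le.mpr hQ
  push_cast at hR
  exact hR

theorem sum_range_one_div_pow_succ {x : ℝ} (hx : 1 < x) (K : ℕ) :
    ∑ k ∈ Finset.range K, 1 / x ^ (k + 1) = (1 - 1 / x ^ K) / (x - 1) := by
  have hx0 : x ≠ 0 := by positivity
  have hx1 : x - 1 ≠ 0 := by linarith
  induction K with
  | zero => simp
  | succ K ih =>
    rw [Finset.sum_range_succ, ih]
    field_simp
    ring

theorem PadicInt.abs_sum_valuation_sub_le {p : ℕ} [Fact p.Prime] {α : ℤ_[p]} {a b K : ℕ}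
    (hab : a ≤ b) (hne : ∀ i ∈ Finset.Ico a b, α - (i : ℤ_[p]) ≠ 0)
    (hK : ∀ i ∈ Finset.Ico a b, (α - (i : ℤ_[p])).valuation ≤ K) :
    |∑ i ∈ Finset.Ico a b, ((α - (i : ℤ_[p])).valuation : ℝ)
      - ((b : ℝ) - a) * ((1 - 1 / (p : ℝ) ^ K) / (p - 1))| ≤ K := by
  have hp : p.Prime := Fact.out
  have hval : ∀ i ∈ Finset.Ico a b, ((α - (i : ℤ_[p])).valuation : ℝ)
      = ∑ k ∈ Finset.range K, if i ≡ α.appr (k + 1) [MOD p ^ (k + 1)] then (1 : ℝ) else 0 := by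
    intro i hi
    have hfilter : (Finset.range K).filter (fun k => i ≡ α.appr (k + 1) [MOD p ^ (k + 1)])
        = Finset.range (α - (i : ℤ_[p])).valuation := by
      ext k
      have := hK i hi
      rw [Finset.mem_filter, ← PadicInt.le_valuation_sub_natCast_iff (hne i hi)]
      simp only [Finset.mem_range]
      omega
    rw [Finset.sum_boole, hfilter, Finset.card_range]
  rw [Finset.sum_congr rfl hval, Finset.sum_comm,
    ← sum_range_one_div_pow_succ (by exact_mod_cast hp.one_lt), Finset.mul_sum,
    ← Finset.sum_sub_distrib]
  refine (Finset.abs_sum_le_sum_abs _ _).trans ?_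
  refine (Finset.sum_le_card_nsmul _ _ 1 fun k _ => ?_).trans (by simp)
  have hcount := Nat.abs_card_Ico_filter_modEq_sub_le hab (pow_pos hp.pos (k + 1))
    (α.appr (k + 1))
  rw [Finset.sum_boole, mul_one_div]
  exact_mod_cast hcount

theorem Polynomial.exists_abs_eval_natCast_le (P : ℤ[X]) :
    ∃ C : ℕ, 0 < C ∧ ∀ i : ℕ, |P.eval (i : ℤ)| ≤ C * ((i : ℤ) + 1) ^ P.natDegree := by
  refine ⟨1 + ∑ j ∈ Finset.range (P.natDegree + 1), (P.coeff j).natAbs, by omega, fun i => ?_⟩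
  have hbound : |P.eval (i : ℤ)|
      ≤ (∑ j ∈ Finset.range (P.natDegree + 1), |P.coeff j|) * ((i : ℤ) + 1) ^ P.natDegree := by
    rw [Polynomial.eval_eq_sum_range, Finset.sum_mul]
    refine (Finset.abs_sum_le_sum_abs _ _).trans (Finset.sum_le_sum fun j hj => ?_)
    rw [abs_mul, abs_of_nonneg (by positivity : (0 : ℤ) ≤ (i : ℤ) ^ j)]
    gcongr
    calc (i : ℤ) ^ j ≤ ((i : ℤ) + 1) ^ j := by gcongr; omega
      _ ≤ ((i : ℤ) + 1) ^ P.natDegree :=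
        pow_le_pow_right₀ (by omega) (by have := Finset.mem_range.mp hj; omega)
  refine hbound.trans ?_
  push_cast
  gcongr
  simp

/-- A Liouville-type bound: an algebraic `p`-adic integer is not too close to natural numbers. -/
theorem PadicInt.exists_pow_valuation_sub_natCast_le {p : ℕ} [Fact p.Prime] {α : ℤ_[p]}
    (halg : IsAlgebraic ℚ (α : ℚ_[p])) :
    ∃ C d m : ℕ, 0 < C ∧ ∀ i : ℕ, m ≤ i →
      α - (i : ℤ_[p]) ≠ 0 ∧ p ^ (α - (i : ℤ_[p])).valuation ≤ C * (i + 1) ^ d := by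
  obtain ⟨P, hP, hPα⟩ := (IsFractionRing.isAlgebraic_iff ℤ ℚ ℚ_[p]).mpr halg
  obtain ⟨C, hC, hbound⟩ := P.exists_abs_eval_natCast_le
  have hroot : (P.map (Int.castRingHom ℤ_[p])).eval α = 0 := by
    have : ((aeval α P : ℤ_[p]) : ℚ_[p]) = 0 := by
      rw [← hPα]
      exact (Polynomial.aeval_algebraMap_apply ℚ_[p] α P).symm
    rw [Polynomial.eval_map]
    exact Subtype.ext this
  obtain ⟨m, hm⟩ : ∃ m : ℕ, ∀ i : ℕ, m ≤ i → P.eval (i : ℤ) ≠ 0 := by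
    refine ⟨∑ r ∈ P.roots.toFinset, r.natAbs + 1, fun i hi h0 => ?_⟩
    have hmem : (i : ℤ) ∈ P.roots.toFinset := by simpa [hP] using h0
    have := Finset.single_le_sum (f := Int.natAbs) (fun _ _ => Nat.zero_le _) hmem
    simp only [Int.natAbs_natCast] at this
    omega
  refine ⟨C, P.natDegree, m, hC, fun i hi => ?_⟩
  have heval : (P.map (Int.castRingHom ℤ_[p])).eval (i : ℤ_[p]) = (P.eval (i : ℤ) : ℤ) := by
    simp
  have hdvd : α - (i : ℤ_[p]) ∣ ((P.eval (i : ℤ) : ℤ) : ℤ_[p]) := by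
    have := Polynomial.sub_dvd_eval_sub α (i : ℤ_[p]) (P.map (Int.castRingHom ℤ_[p]))
    rwa [hroot, heval, zero_sub, dvd_neg] at this
  have hne : α - (i : ℤ_[p]) ≠ 0 := by
    intro h
    rw [h, zero_dvd_iff] at hdvd
    exact hm i hi (by exact_mod_cast hdvd)
  refine ⟨hne, ?_⟩
  have hpow := Ideal.mem_span_singleton.mp
    ((PadicInt.mem_span_pow_iff_le_valuation _ hne _).mpr le_rfl)
  have hle := Int.le_of_dvd (abs_pos.mpr (hm i hi))
    ((dvd_abs _ _).mpr ((PadicInt.pow_p_dvd_int_iff _ _).mp (hpow.trans hdvd)))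
  exact_mod_cast hle.trans (hbound i)

theorem tendsto_natLog_mul_pow_div (p C d : ℕ) (hC : 0 < C) :
    Tendsto (fun N : ℕ => (Nat.log p (C * (N + 1) ^ d) : ℝ) / N) atTop (𝓝 0) := by
  have hlog : Tendsto (fun N : ℕ => Real.log ((N : ℝ) + 1) / N) atTop (𝓝 0) := by
    have h1 : Tendsto (fun N : ℕ => Real.log ((N : ℝ) + 1) / ((N : ℝ) + 1)) atTop (𝓝 0) :=
      Real.isLittleO_log_id_atTop.tendsto_div_nhds_zero.comp
        (tendsto_atTop_add_const_right _ 1 tendsto_natCast_atTop_atTop)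
    have h2 : Tendsto (fun N : ℕ => 1 + 1 / (N : ℝ)) atTop (𝓝 (1 + 0)) :=
      tendsto_const_nhds.add tendsto_one_div_atTop_nhds_zero_nat
    have h3 := h1.mul h2
    rw [zero_mul] at h3
    refine h3.congr' ?_
    filter_upwards [eventually_gt_atTop 0] with N hN
    have : (N : ℝ) ≠ 0 := by positivity
    field_simp
  have hup : Tendsto (fun N : ℕ => (Real.log C / Real.log p) / (N : ℝ)
      + (d / Real.log p) * (Real.log ((N : ℝ) + 1) / N)) atTop (𝓝 0) := by
    simpa using (tendsto_const_div_atTop_nhds_zero_nat (Real.log C / Real.log p)).add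
      (hlog.const_mul (d / Real.log p))
  refine squeeze_zero (fun N => by positivity) (fun N => ?_) hup
  have hle := Real.natLog_le_logb (C * (N + 1) ^ d) p
  rw [Real.logb] at hle
  push_cast at hle
  rw [Real.log_mul (by positivity) (by positivity), Real.log_pow] at hle
  calc _ ≤ ((Real.log C + d * Real.log ((N : ℝ) + 1)) / Real.log p) / N := by gcongr
    _ = _ := by ring

/-- Clark's lemma, integral case: for a `p`-adic integer `α` algebraic over `ℚ`,
the averages `(1/N) ∑_{i=m}^N ord_p(α - i)` converge to `1/(p-1)` for suitable `m`. -/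
theorem clark_lemma_integral (p : ℕ) [Fact p.Prime] (α : ℤ_[p])
    (halg : IsAlgebraic ℚ (α : ℚ_[p])) :
    ∃ m : ℕ, (∀ i : ℕ, m ≤ i → (α : ℚ_[p]) ≠ (i : ℚ_[p])) ∧
      Filter.Tendsto
        (fun N : ℕ => (1 / (N : ℝ)) *
          ∑ i ∈ Finset.Icc m N, ordp p ((α : ℚ_[p]) - (i : ℚ_[p])))
        Filter.atTop (nhds (1 / ((p : ℝ) - 1))) := by
  have hp : p.Prime := Fact.out
  obtain ⟨C, d, m, hC, hbound⟩ := PadicInt.exists_pow_valuation_sub_natCast_le halg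
  have hord : ∀ i : ℕ, m ≤ i → ordp p ((α : ℚ_[p]) - (i : ℚ_[p]))
      = ((α - (i : ℤ_[p])).valuation : ℝ) := by
    intro i hi
    rw [← ordp_coe_padicInt (hbound i hi).1]
    push_cast
    rfl
  refine ⟨m, fun i hi h => (hbound i hi).1 (sub_eq_zero.mpr (Subtype.ext (by simpa using h))), ?_⟩
  set K : ℕ → ℕ := fun N => Nat.log p (C * (N + 1) ^ (d + 1))
  have herr : Tendsto (fun N : ℕ => (K N : ℝ) / N + ((m : ℝ) + 3) / N) atTop (𝓝 0) := by
    simpa using (tendsto_natLog_mul_pow_div p C (d + 1) hC).add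
      (tendsto_const_div_atTop_nhds_zero_nat ((m : ℝ) + 3))
  rw [tendsto_iff_dist_tendsto_zero]
  refine squeeze_zero' (Eventually.of_forall fun _ => dist_nonneg) ?_ herr
  filter_upwards [eventually_ge_atTop (m + 1)] with N hN
  have hIcc : Finset.Icc m N = Finset.Ico m (N + 1) := by
    ext i
    simp only [Finset.mem_Icc, Finset.mem_Ico]
    omega
  have hsum := PadicInt.abs_sum_valuation_sub_le (α := α) (a := m) (b := N + 1) (K := K N)
    (by omega) (fun i hi => (hbound i (Finset.mem_Ico.mp hi).1).1) (fun i hi => by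
      obtain ⟨hmi, hiN⟩ := Finset.mem_Ico.mp hi
      refine Nat.le_log_of_pow_le hp.one_lt ((hbound i hmi).2.trans ?_)
      gcongr
      · omega
      · omega
      · omega)
  rw [hIcc, Finset.sum_congr rfl fun i hi => hord i (Finset.mem_Ico.mp hi).1]
  set S := ∑ i ∈ Finset.Ico m (N + 1), ((α - (i : ℤ_[p])).valuation : ℝ)
  have hp2 : (2 : ℝ) ≤ p := by exact_mod_cast hp.two_le
  have hN0 : (0 : ℝ) < N := by exact_mod_cast (by omega : 0 < N)
  have hmN : (m : ℝ) + 1 ≤ N := by exact_mod_cast hN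
  have hpK : (N : ℝ) + 1 ≤ (p : ℝ) ^ (K N) * p := by
    have h1 : C * (N + 1) ^ (d + 1) < p ^ (K N + 1) := Nat.lt_pow_succ_log_self hp.one_lt _
    have h2 : N + 1 ≤ C * (N + 1) ^ (d + 1) :=
      (Nat.le_self_pow (by omega) _).trans (Nat.le_mul_of_pos_left _ hC)
    rw [← pow_succ]
    exact_mod_cast h2.trans h1.le
  have htail0 : 0 ≤ ((N : ℝ) + 1 - m) * (1 / (p : ℝ) ^ K N / (p - 1)) :=
    mul_nonneg (by linarith) (div_nonneg (by positivity) (by linarith))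
  have htail : ((N : ℝ) + 1 - m) * (1 / (p : ℝ) ^ K N / (p - 1)) ≤ 2 := by
    rw [div_div, mul_one_div, div_le_iff₀ (by apply mul_pos <;> [positivity; linarith])]
    have hpow : (0 : ℝ) < (p : ℝ) ^ K N := by positivity
    nlinarith [Nat.cast_nonneg (α := ℝ) m]
  have hq0 : 0 ≤ 1 / ((p : ℝ) - 1) := by apply div_nonneg <;> linarith
  have hq1 : 1 / ((p : ℝ) - 1) ≤ 1 := by rw [div_le_one (by linarith)]; linarith
  have hm0 : (0 : ℝ) ≤ m := Nat.cast_nonneg m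
  have hmain : |S - N * (1 / ((p : ℝ) - 1))| ≤ K N + (m + 3) := by
    have hsplit : ((N + 1 : ℕ) - m : ℝ) * ((1 - 1 / (p : ℝ) ^ K N) / (p - 1))
        = N * (1 / ((p : ℝ) - 1)) + (1 / ((p : ℝ) - 1) - m * (1 / ((p : ℝ) - 1)))
          - ((N : ℝ) + 1 - m) * (1 / (p : ℝ) ^ K N / (p - 1)) := by
      push_cast
      ring
    rw [hsplit, abs_le] at hsum
    have hmq : m * (1 / ((p : ℝ) - 1)) ≤ m := mul_le_of_le_one_right hm0 hq1
    have hmq0 : 0 ≤ m * (1 / ((p : ℝ) - 1)) := mul_nonneg hm0 hq0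
    rw [abs_le]
    constructor <;> linarith [hsum.1, hsum.2]
  have hdist : 1 / (N : ℝ) * S - 1 / ((p : ℝ) - 1) = (S - N * (1 / ((p : ℝ) - 1))) / N := by
    field_simp
  rw [Real.dist_eq, hdist, abs_div, abs_of_pos hN0, ← add_div]
  gcongr
end

section
/- Let p be a prime and let P be a nonzero polynomial over ℂ_p all of whose coefficients are algebraic over ℚ. Then there exist a natural number m and a real number L such that P(i) ≠ 0 for all natural numbers i ≥ m and the averages (1/N) · Σ_{i=m}^{N} ord_p(P(i)) converge to L as N → ∞. -/
open Filter Topology Polynomial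

/-- The Cesàro averages `(1/N) ∑_{i<N} u i` converge to `L`. -/
def HasAverage (u : ℕ → ℝ) (L : ℝ) : Prop :=
  Tendsto (fun N : ℕ => (∑ i ∈ Finset.range N, u i) / N) atTop (𝓝 L)

theorem HasAverage.add {u v : ℕ → ℝ} {L M : ℝ} (hu : HasAverage u L) (hv : HasAverage v M) :
    HasAverage (fun i => u i + v i) (L + M) := by
  simpa only [HasAverage, Finset.sum_add_distrib, add_div] using Tendsto.add hu hv

theorem HasAverage.of_periodic {u : ℕ → ℝ} {q : ℕ} (hq : 0 < q) (hu : Function.Periodic u q) :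
    HasAverage u ((∑ i ∈ Finset.range q, u i) / q) := by
  have hq' : (q : ℝ) ≠ 0 := by positivity
  set L := (∑ i ∈ Finset.range q, u i) / q with hL
  set D : ℕ → ℝ := fun N => ∑ i ∈ Finset.range N, u i - N * L with hD
  have hper : Function.Periodic D q := by
    intro N
    have h1 : ∑ i ∈ Finset.range (N + q), u i
        = ∑ i ∈ Finset.range N, u i + ∑ i ∈ Finset.range q, u i := by
      rw [add_comm N q, Finset.sum_range_add, add_comm]
      congr 1
      exact Finset.sum_congr rfl fun i _ => by rw [add_comm, hu]
    have h2 : ∑ i ∈ Finset.range q, u i = q * L := by rw [hL]; field_simp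
    simp only [hD, h1, h2]
    push_cast
    ring
  obtain ⟨C, hC⟩ := (Set.finite_range (fun r : Fin q => |D r|)).bddAbove
  have hbound : ∀ N, |D N| ≤ C := fun N => by
    rw [← hper.map_mod_nat N]
    exact hC ⟨⟨N % q, Nat.mod_lt _ hq⟩, rfl⟩
  have hzero : Tendsto (fun N : ℕ => D N / N) atTop (𝓝 0) := by
    refine squeeze_zero_norm (fun N => ?_) (tendsto_const_div_atTop_nhds_zero_nat C)
    rw [norm_div, Real.norm_natCast, Real.norm_eq_abs]
    gcongr
    exact hbound N
  have h := hzero.add_const L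
  rw [zero_add] at h
  refine h.congr' ?_
  filter_upwards [eventually_gt_atTop 0] with N hN
  have : (N : ℝ) ≠ 0 := by positivity
  simp only [hD]
  field_simp
  ring

theorem HasAverage.const (c : ℝ) : HasAverage (fun _ => c) c := by
  simpa using HasAverage.of_periodic (u := fun _ => c) one_pos (fun _ => rfl)

theorem exists_hasAverage_multiset_sum {ι : Type*} (s : Multiset ι) (u : ι → ℕ → ℝ)
    (h : ∀ a ∈ s, ∃ L, HasAverage (u a) L) :
    ∃ L, HasAverage (fun i => (s.map fun a => u a i).sum) L := by
  induction s using Multiset.induction_on with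
  | empty => exact ⟨0, by simpa using HasAverage.const 0⟩
  | cons a s ih =>
    obtain ⟨L, hL⟩ := h a (Multiset.mem_cons_self a s)
    obtain ⟨M, hM⟩ := ih fun b hb => h b (Multiset.mem_cons_of_mem hb)
    exact ⟨L + M, by simpa using hL.add hM⟩

/-- A sequence whose averages are approximated, up to any prescribed error, by those of a
sequence having an average, has an average itself. -/
theorem exists_hasAverage_of_approx {u : ℕ → ℝ}
    (h : ∀ ε > 0, ∃ v L, HasAverage v L ∧
      ∀ᶠ N : ℕ in atTop, |∑ i ∈ Finset.range N, (u i - v i)| ≤ ε * N) :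
    ∃ L, HasAverage u L := by
  refine cauchySeq_tendsto_of_complete (Metric.cauchySeq_iff'.2 fun ε hε => ?_)
  obtain ⟨v, L, hv, hN⟩ := h (ε / 8) (by positivity)
  have key : ∀ᶠ N : ℕ in atTop, |(∑ i ∈ Finset.range N, u i) / N - L| < ε / 2 := by
    filter_upwards [hN, eventually_gt_atTop 0, Metric.tendsto_nhds.1 hv (ε / 8) (by positivity)]
      with N h1 h2 h3
    have hN0 : (0 : ℝ) < N := by positivity
    have h4 : |(∑ i ∈ Finset.range N, u i) / N - (∑ i ∈ Finset.range N, v i) / N| ≤ ε / 8 := by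
      rw [← sub_div, ← Finset.sum_sub_distrib, abs_div, abs_of_pos hN0]
      exact (div_le_iff₀ hN0).2 h1
    rw [Real.dist_eq] at h3
    have := abs_sub_le ((∑ i ∈ Finset.range N, u i) / N) ((∑ i ∈ Finset.range N, v i) / N) L
    linarith
  obtain ⟨M, hM⟩ := eventually_atTop.1 key
  refine ⟨M, fun n hn => ?_⟩
  have h1 := hM n hn
  have h2 := hM M le_rfl
  rw [Real.dist_eq]
  rw [abs_sub_comm] at h2
  have := abs_sub_le ((∑ i ∈ Finset.range n, u i) / n) L ((∑ i ∈ Finset.range M, u i) / M)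
  linarith

theorem HasAverage.tendsto_sum_Icc {u : ℕ → ℝ} {m : ℕ} {L : ℝ}
    (h : HasAverage (fun i => u (m + i)) L) :
    Tendsto (fun N : ℕ => (1 / (N : ℝ)) * ∑ i ∈ Finset.Icc m N, u i) atTop (𝓝 L) := by
  have h1 : Tendsto (fun N : ℕ => N + 1 - m) atTop atTop :=
    tendsto_atTop_mono (fun N => by omega) (tendsto_sub_atTop_nat m)
  have h2 : Tendsto (fun N : ℕ => ((N + 1 - m : ℕ) : ℝ) / N) atTop (𝓝 1) := by
    have h3 := (tendsto_const_div_atTop_nhds_zero_nat (1 - (m : ℝ))).const_add 1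
    rw [add_zero] at h3
    refine h3.congr' ?_
    filter_upwards [eventually_gt_atTop m] with N hN
    have : (N : ℝ) ≠ 0 := by
      have : 0 < N := by omega
      positivity
    rw [Nat.cast_sub (by omega)]
    push_cast
    field_simp
    ring
  have h3 := (Tendsto.comp h h1).mul h2
  rw [mul_one] at h3
  refine h3.congr' ?_
  filter_upwards [eventually_gt_atTop m] with N hN
  have : ((N + 1 - m : ℕ) : ℝ) ≠ 0 := by
    have : 0 < N + 1 - m := by omega
    positivity
  have h5 : ∑ i ∈ Finset.Icc m N, u i = ∑ i ∈ Finset.range (N + 1 - m), u (m + i) := by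
    rw [← Finset.sum_Ico_eq_sum_range]
    rfl
  simp only [Function.comp, h5]
  field_simp

/-- If `x ≤ B`, the excess of `x` over `k` is at most the number of integers in `[k, B]` that
are at most `x`. -/
theorem max_sub_le_card_filter {x : ℝ} {k B : ℕ} (hx : x ≤ B) :
    max x k - k ≤ ((Finset.Icc k B).filter fun j : ℕ => (j : ℝ) ≤ x).card := by
  rcases le_total x k with h | h
  · simp [h]
  · have hx0 : 0 ≤ x := (Nat.cast_nonneg k).trans h
    have hsub : Finset.Icc k ⌊x⌋₊ ⊆ (Finset.Icc k B).filter fun j : ℕ => (j : ℝ) ≤ x := by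
      intro j hj
      rw [Finset.mem_Icc] at hj
      have hjx : (j : ℝ) ≤ x := (Nat.cast_le.2 hj.2).trans (Nat.floor_le hx0)
      simp only [Finset.mem_filter, Finset.mem_Icc]
      exact ⟨⟨hj.1, by exact_mod_cast hjx.trans hx⟩, hjx⟩
    have hcard := Finset.card_le_card hsub
    rw [Nat.card_Icc] at hcard
    have hk : k ≤ ⌊x⌋₊ := Nat.le_floor h
    have : ((⌊x⌋₊ + 1 - k : ℕ) : ℝ) = ⌊x⌋₊ + 1 - k := by
      rw [Nat.cast_sub (by omega)]; push_cast; ring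
    have hcard' : ((⌊x⌋₊ + 1 - k : ℕ) : ℝ) ≤ _ := Nat.cast_le.2 hcard
    rw [max_eq_left h]
    have := Nat.lt_floor_add_one x
    linarith

/-- A set of pairwise congruent integers in `[0, N)` has at most `N / q + 1` elements. -/
theorem card_le_of_pairwise_modEq {q N : ℕ} {s : Finset ℕ} (hs : s ⊆ Finset.range N)
    (h : ∀ i ∈ s, ∀ j ∈ s, i ≡ j [MOD q]) : s.card ≤ N / q + 1 := by
  rw [← Finset.card_range (N / q + 1)]
  refine Finset.card_le_card_of_injOn (· / q) (fun i hi => ?_) (fun i hi j hj hij => ?_)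
  · have := Finset.mem_range.1 (hs hi)
    simp only [Finset.coe_range, Set.mem_Iio]
    exact Nat.lt_succ_of_le (Nat.div_le_div_right this.le)
  · rw [← Nat.div_add_mod i q, ← Nat.div_add_mod j q, h i hi j hj]
    simp only at hij
    rw [hij]

/-- A sequence whose superlevel sets `{u ≥ k}` consist of pairwise congruent integers modulo
`p ^ k`, whose truncations are periodic, and which grows sublinearly, has an average. -/
theorem exists_hasAverage_of_modEq {p : ℕ} (hp : 1 < p) {u : ℕ → ℝ}
    (hmod : ∀ (k i j : ℕ), (k : ℝ) ≤ u i → (k : ℝ) ≤ u j → i ≡ j [MOD p ^ k])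
    (hper : ∀ k : ℕ, Function.Periodic (fun i => min (u i) k) (p ^ k))
    (B : ℕ → ℕ) (hB : ∀ N, ∀ i < N, u i ≤ B N)
    (hB0 : Tendsto (fun N : ℕ => (B N : ℝ) / N) atTop (𝓝 0)) :
    ∃ L, HasAverage u L := by
  have hp0 : 0 < p := by omega
  have hpR : (2 : ℝ) ≤ p := by exact_mod_cast hp
  have hbound : ∀ k N : ℕ, ∑ i ∈ Finset.range N, (u i - min (u i) k)
      ≤ N * (2 * (1 / (p : ℝ)) ^ k) + (B N + 1) := by
    intro k N
    have hcount : ∀ j : ℕ, (((Finset.range N).filter fun i => (j : ℝ) ≤ u i).card : ℝ)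
        ≤ N * (1 / (p : ℝ)) ^ j + 1 := by
      intro j
      have h1 := card_le_of_pairwise_modEq (q := p ^ j) (Finset.filter_subset
        (fun i => (j : ℝ) ≤ u i) (Finset.range N)) fun a ha b hb =>
          hmod j a b (Finset.mem_filter.1 ha).2 (Finset.mem_filter.1 hb).2
      have h2 : ((N / p ^ j : ℕ) : ℝ) ≤ N / ((p ^ j : ℕ) : ℝ) := Nat.cast_div_le
      have h3 : (((Finset.range N).filter fun i => (j : ℝ) ≤ u i).card : ℝ)
        ≤ ((N / p ^ j : ℕ) : ℝ) + 1 := by exact_mod_cast h1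
      push_cast at h2
      rw [one_div, inv_pow, ← div_eq_mul_inv]
      linarith
    have hgeom : ∑ j ∈ Finset.Icc k (B N), (1 / (p : ℝ)) ^ j ≤ 2 * (1 / (p : ℝ)) ^ k := by
      have hr : 1 / (p : ℝ) ≤ 1 / 2 := by gcongr
      have h1 : ∑ j ∈ Finset.Icc k (B N), (1 / (p : ℝ)) ^ j
          = ∑ j ∈ Finset.range (B N + 1 - k), (1 / (p : ℝ)) ^ (k + j) := by
        rw [← Finset.sum_Ico_eq_sum_range]
        rfl
      rw [h1]
      simp only [pow_add]
      rw [← Finset.mul_sum, mul_comm]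
      gcongr
      calc _ ≤ ∑ j ∈ Finset.range (B N + 1 - k), (1 / 2 : ℝ) ^ j := by gcongr
        _ ≤ 2 := sum_geometric_two_le _
    calc ∑ i ∈ Finset.range N, (u i - min (u i) k)
        ≤ ∑ i ∈ Finset.range N,
            (((Finset.Icc k (B N)).filter fun j : ℕ => (j : ℝ) ≤ u i).card : ℝ) := by
          refine Finset.sum_le_sum fun i hi => ?_
          have h1 := max_sub_le_card_filter (k := k) (hB N i (Finset.mem_range.1 hi))
          have h2 := min_add_max (u i) (k : ℝ)
          linarith
      _ = ∑ j ∈ Finset.Icc k (B N),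
            (((Finset.range N).filter fun i => (j : ℝ) ≤ u i).card : ℝ) := by
          simp only [Finset.card_filter, Nat.cast_sum]
          exact Finset.sum_comm
      _ ≤ ∑ j ∈ Finset.Icc k (B N), (N * (1 / (p : ℝ)) ^ j + 1) :=
          Finset.sum_le_sum fun j _ => hcount j
      _ = N * ∑ j ∈ Finset.Icc k (B N), (1 / (p : ℝ)) ^ j + ((B N + 1 - k : ℕ) : ℝ) := by
          rw [Finset.sum_add_distrib, ← Finset.mul_sum]
          simp
      _ ≤ N * (2 * (1 / (p : ℝ)) ^ k) + (B N + 1) := by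
          gcongr
          exact_mod_cast Nat.sub_le (B N + 1) k
  refine exists_hasAverage_of_approx fun ε hε => ?_
  obtain ⟨k, hk⟩ := exists_pow_lt_of_lt_one (show (0 : ℝ) < ε / 4 by positivity)
    (show 1 / (p : ℝ) < 1 by rw [div_lt_one (by positivity)]; linarith)
  refine ⟨_, _, HasAverage.of_periodic (by positivity) (hper k), ?_⟩
  have hlim := hB0.add (tendsto_const_div_atTop_nhds_zero_nat (1 : ℝ))
  rw [add_zero] at hlim
  filter_upwards [hlim.eventually_lt_const (show (0 : ℝ) < ε / 2 by positivity),
    eventually_gt_atTop 0] with N h1 h2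
  have hN0 : (0 : ℝ) < N := by positivity
  rw [← add_div, div_lt_iff₀ hN0] at h1
  rw [abs_of_nonneg (Finset.sum_nonneg fun i _ => sub_nonneg.2 (min_le_left _ _))]
  have h3 := mul_le_mul_of_nonneg_left hk.le hN0.le
  linarith [hbound k N]

theorem Padic.one_le_abs_mul_norm_intCast {p : ℕ} [Fact p.Prime] {n : ℤ} (hn : n ≠ 0) :
    1 ≤ |(n : ℝ)| * ‖(n : ℚ_[p])‖ := by
  have hp : (0 : ℝ) < p := by exact_mod_cast (Fact.out : p.Prime).pos
  rw [Padic.norm_eq_zpow_neg_valuation (by exact_mod_cast hn), Padic.valuation_intCast,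
    zpow_neg, zpow_natCast, ← div_eq_mul_inv, one_le_div (by positivity)]
  have h : p ^ padicValNat p n.natAbs ≤ n.natAbs :=
    Nat.le_of_dvd (Int.natAbs_pos.2 hn) pow_padicValNat_dvd
  rw [← Int.cast_abs, Int.abs_eq_natAbs]
  exact_mod_cast h

theorem Polynomial.norm_eval_le_sum_norm_coeff {K : Type*} [NormedField K] (g : K[X]) {x : K}
    (hx : ‖x‖ ≤ 1) : ‖g.eval x‖ ≤ ∑ k ∈ Finset.range (g.natDegree + 1), ‖g.coeff k‖ := by
  rw [Polynomial.eval_eq_sum_range]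
  refine (norm_sum_le _ _).trans (Finset.sum_le_sum fun k _ => ?_)
  rw [norm_mul, norm_pow]
  exact mul_le_of_le_one_right (norm_nonneg _) (pow_le_one₀ (norm_nonneg _) hx)

theorem Polynomial.abs_eval_natCast_le_s9 (f : ℤ[X]) :
    ∃ C : ℝ, ∀ i : ℕ, |((f.eval (i : ℤ) : ℤ) : ℝ)| ≤ C * ((i : ℝ) + 1) ^ f.natDegree := by
  refine ⟨∑ k ∈ Finset.range (f.natDegree + 1), |(f.coeff k : ℝ)|, fun i => ?_⟩
  rw [Polynomial.eval_eq_sum_range, Finset.sum_mul]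
  push_cast
  refine (Finset.abs_sum_le_sum_abs _ _).trans (Finset.sum_le_sum fun k hk => ?_)
  rw [abs_mul, abs_of_nonneg (by positivity : (0 : ℝ) ≤ (i : ℝ) ^ k)]
  gcongr
  calc (i : ℝ) ^ k ≤ ((i : ℝ) + 1) ^ k := by gcongr; linarith
    _ ≤ _ := pow_le_pow_right₀ (by linarith [Nat.cast_nonneg (α := ℝ) i])
      (Nat.lt_succ_iff.1 (Finset.mem_range.1 hk))

/-- An algebraic number that is not a natural number is a root of an integer polynomial
with no natural roots. -/
theorem IsAlgebraic.exists_int_polynomial {K : Type*} [Field K] [CharZero K] {α : K}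
    (hα : IsAlgebraic ℚ α) (hnat : ∀ i : ℕ, (i : K) ≠ α) :
    ∃ f : ℤ[X], (f.map (Int.castRingHom K)).IsRoot α ∧ ∀ i : ℕ, f.eval (i : ℤ) ≠ 0 := by
  obtain ⟨b, hb, hf⟩ := IsLocalization.integerNormalization_spec (nonZeroDivisors ℤ) (minpoly ℚ α)
  set f := IsLocalization.integerNormalization (nonZeroDivisors ℤ) (minpoly ℚ α) with hfdef
  refine ⟨f, ?_, fun i hi => ?_⟩
  · have h := IsLocalization.integerNormalization_aeval_eq_zero (nonZeroDivisors ℤ)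
      (minpoly ℚ α) (minpoly.aeval ℚ α)
    rw [← hfdef, aeval_def, algebraMap_int_eq, ← eval_map] at h
    exact h
  · have h1 : (f.map (algebraMap ℤ ℚ)).eval (i : ℚ) = 0 := by
      rw [eval_map, eval₂_at_natCast, hi, map_zero]
    rw [hf, eval_smul, smul_eq_zero] at h1
    have h2 := minpoly.root hα.isIntegral (h1.resolve_left (nonZeroDivisors.ne_zero hb))
    exact hnat i (by simpa using h2)

theorem IsUltrametricDist.norm_sub_le_max {S : Type*} [SeminormedAddCommGroup S]
    [IsUltrametricDist S] (x y : S) : ‖x - y‖ ≤ max ‖x‖ ‖y‖ := by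
  simpa only [sub_eq_add_neg, norm_neg] using norm_add_le_max x (-y)

theorem IsPadicComplex.norm_intCast (p : ℕ) [Fact p.Prime] {K : Type*}
    [NontriviallyNormedField K] [Algebra ℚ_[p] K] [IsPadicComplex p K] (n : ℤ) :
    ‖(n : K)‖ = ‖(n : ℚ_[p])‖ := by
  have h := (IsPadicComplex.isometry_algebraMap (p := p) (K := K)).norm_map_of_map_zero
    (map_zero _) (n : ℚ_[p])
  rwa [map_intCast] at h

/-- A `p`-adic Liouville inequality: the distance from an algebraic number to a natural number `i`
is bounded below by a constant times a negative power of `i + 1`. -/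
theorem IsPadicComplex.exists_liouville_bound (p : ℕ) [Fact p.Prime] {K : Type*}
    [NontriviallyNormedField K] [Algebra ℚ_[p] K] [IsPadicComplex p K] [CharZero K] {α : K}
    (hα : IsAlgebraic ℚ α) (hnat : ∀ i : ℕ, (i : K) ≠ α) :
    ∃ (C : ℝ) (d : ℕ), ∀ i : ℕ, 1 ≤ C * ((i : ℝ) + 1) ^ d * ‖(i : K) - α‖ := by
  obtain ⟨f, hroot, hf⟩ := hα.exists_int_polynomial hnat
  obtain ⟨C, hC⟩ := f.abs_eval_natCast_le_s9
  obtain ⟨g, hg⟩ := dvd_iff_isRoot.2 hroot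
  refine ⟨C * ∑ k ∈ Finset.range (g.natDegree + 1), ‖g.coeff k‖, f.natDegree, fun i => ?_⟩
  have hi : ‖(i : K)‖ ≤ 1 := by
    have h := IsPadicComplex.norm_intCast p (K := K) i
    rw [Int.cast_natCast] at h
    exact h.trans_le (Padic.norm_int_le_one _)
  have heval : ((f.eval (i : ℤ) : ℤ) : K) = ((i : K) - α) * g.eval (i : K) := by
    have h := congrArg (eval (i : K)) hg
    rw [eval_map, eval₂_at_natCast, eval_mul, eval_sub, eval_X, eval_C] at h
    simpa using h
  have h1 := Padic.one_le_abs_mul_norm_intCast (p := p) (hf i)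
  rw [← IsPadicComplex.norm_intCast p (K := K), heval, norm_mul] at h1
  calc (1 : ℝ) ≤ _ := h1
    _ ≤ (C * ((i : ℝ) + 1) ^ f.natDegree) * (‖(i : K) - α‖ *
        ∑ k ∈ Finset.range (g.natDegree + 1), ‖g.coeff k‖) := by
      gcongr
      · exact (abs_nonneg _).trans (hC i)
      · exact hC i
      · exact g.norm_eval_le_sum_norm_coeff hi
    _ = _ := by ring

theorem natCast_le_ordp_iff {p : ℕ} [Fact p.Prime] {K : Type*} [NormedField K] {k : ℕ} {x : K}
    (hx : x ≠ 0) :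
    (k : ℝ) ≤ ordp p x ↔ ‖x‖ ≤ (p : ℝ) ^ (-k : ℤ) := by
  have hp : (1 : ℝ) < p := by exact_mod_cast (Fact.out : p.Prime).one_lt
  have hp0 : (0 : ℝ) < p := by linarith
  rw [ordp, le_div_iff₀ (Real.log_pos hp), ← Real.log_le_log_iff (norm_pos_iff.2 hx)
    (by positivity), Real.log_zpow]
  push_cast
  constructor <;> intro h <;> linarith

theorem min_ordp_congr {p : ℕ} [Fact p.Prime] {K : Type*} [NormedField K] [IsUltrametricDist K]
    {k : ℕ} {x y : K} (hx : x ≠ 0) (hy : y ≠ 0)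
    (hxy : ‖x - y‖ ≤ (p : ℝ) ^ (-k : ℤ)) : min (ordp p x) k = min (ordp p y) k := by
  rcases le_or_gt ‖x‖ ((p : ℝ) ^ (-k : ℤ)) with h | h
  · have hy' : ‖y‖ ≤ (p : ℝ) ^ (-k : ℤ) := by
      have h1 := IsUltrametricDist.norm_sub_le_max x (x - y)
      rw [sub_sub_cancel] at h1
      exact h1.trans (max_le h hxy)
    rw [min_eq_right ((natCast_le_ordp_iff hx).2 h), min_eq_right ((natCast_le_ordp_iff hy).2 hy')]
  · have h1 : ‖x‖ = ‖y‖ := by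
      rw [← norm_neg y]
      refine IsUltrametricDist.norm_eq_of_add_norm_lt_max ?_
      rw [← sub_eq_add_neg]
      exact (hxy.trans_lt h).trans_le (le_max_left _ _)
    rw [ordp, ordp, h1]

theorem exists_hasAverage_ordp_natCast_sub {p : ℕ} [Fact p.Prime] {K : Type*}
    [NontriviallyNormedField K] [Algebra ℚ_[p] K] [IsPadicComplex p K] [CharZero K] {α : K}
    (hα : IsAlgebraic ℚ α) (hnat : ∀ i : ℕ, (i : K) ≠ α) :
    ∃ L, HasAverage (fun i => ordp p ((i : K) - α)) L := by
  have : IsUltrametricDist K := IsPadicComplex.ultrametric (p := p)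
  have hp : 1 < p := (Fact.out : p.Prime).one_lt
  have hlogp : 0 < Real.log p := Real.log_pos (by exact_mod_cast hp)
  have hne : ∀ i : ℕ, (i : K) - α ≠ 0 := fun i => sub_ne_zero.2 (hnat i)
  obtain ⟨C, d, hC⟩ := IsPadicComplex.exists_liouville_bound p hα hnat
  have hCpos : 0 < C := by
    by_contra! h
    have h1 := hC 0
    have : C * (((0 : ℕ) : ℝ) + 1) ^ d * ‖((0 : ℕ) : K) - α‖ ≤ 0 :=
      mul_nonpos_of_nonpos_of_nonneg (mul_nonpos_of_nonpos_of_nonneg h (by positivity))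
        (norm_nonneg _)
    linarith
  have hord : ∀ i : ℕ, ordp p ((i : K) - α)
      ≤ (Real.log C + d * Real.log ((i : ℝ) + 1)) / Real.log p := by
    intro i
    have hw : 0 < ‖(i : K) - α‖ := norm_pos_iff.2 (hne i)
    have h1 := Real.log_nonneg (hC i)
    rw [Real.log_mul (by positivity) hw.ne', Real.log_mul hCpos.ne' (by positivity),
      Real.log_pow] at h1
    rw [ordp]
    gcongr
    linarith
  have hcong : ∀ (i j k : ℕ), ‖(i : K) - (j : K)‖ ≤ (p : ℝ) ^ (-k : ℤ) ↔ i ≡ j [MOD p ^ k] := by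
    intro i j k
    have h := IsPadicComplex.norm_intCast p (K := K) ((i : ℤ) - j)
    rw [Int.cast_sub, Int.cast_natCast, Int.cast_natCast] at h
    rw [h, Padic.norm_int_le_pow_iff_dvd, Nat.ModEq.comm, Nat.modEq_iff_dvd]
    push_cast
    rfl
  refine exists_hasAverage_of_modEq hp (fun k i j hi hj => ?_) (fun k i => ?_)
    (fun N => ⌈(|Real.log C| + d * Real.log N) / Real.log p⌉₊) (fun N i hi => ?_) ?_
  · rw [natCast_le_ordp_iff (hne _)] at hi hj
    have h := IsUltrametricDist.norm_sub_le_max ((i : K) - α) ((j : K) - α)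
    rw [sub_sub_sub_cancel_right] at h
    exact (hcong i j k).1 (h.trans (max_le hi hj))
  · refine min_ordp_congr (hne _) (hne _) ?_
    rw [sub_sub_sub_cancel_right]
    exact (hcong _ _ k).2 (by simp [Nat.ModEq])
  · refine (hord i).trans (le_trans ?_ (Nat.le_ceil _))
    have : (i : ℝ) + 1 ≤ N := by exact_mod_cast hi
    gcongr
    exact le_abs_self _
  · have hlog : Tendsto (fun N : ℕ => Real.log N / N) atTop (𝓝 0) :=
      (Real.isLittleO_log_id_atTop.tendsto_div_nhds_zero).comp tendsto_natCast_atTop_atTop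
    have hupper : Tendsto (fun N : ℕ => |Real.log C| / Real.log p / N
        + d / Real.log p * (Real.log N / N) + 1 / N) atTop (𝓝 0) := by
      simpa using ((tendsto_const_div_atTop_nhds_zero_nat (|Real.log C| / Real.log p)).add
        (hlog.const_mul (d / Real.log p))).add (tendsto_const_div_atTop_nhds_zero_nat 1)
    refine squeeze_zero (fun N => by positivity) (fun N => ?_) hupper
    have hnonneg : 0 ≤ (|Real.log C| + d * Real.log N) / Real.log p := by
      have := Real.log_natCast_nonneg N
      positivity
    calc _ ≤ ((|Real.log C| + d * Real.log N) / Real.log p + 1) / N := by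
          gcongr
          exact (Nat.ceil_lt_add_one hnonneg).le
      _ = _ := by ring

theorem ordp_mul {p : ℕ} {K : Type*} [NormedField K] {x y : K} (hx : x ≠ 0) (hy : y ≠ 0) :
    ordp p (x * y) = ordp p x + ordp p y := by
  rw [ordp, ordp, ordp, norm_mul, Real.log_mul (norm_ne_zero_iff.2 hx) (norm_ne_zero_iff.2 hy)]
  ring

theorem ordp_multiset_prod {p : ℕ} {K : Type*} [NormedField K] {s : Multiset K}
    (hs : ∀ x ∈ s, x ≠ 0) :
    ordp p s.prod = (s.map (ordp p)).sum := by
  induction s using Multiset.induction_on with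
  | empty => simp [ordp]
  | cons a s ih =>
    have hs' : ∀ x ∈ s, x ≠ 0 := fun x hx => hs x (Multiset.mem_cons_of_mem hx)
    rw [Multiset.prod_cons, ordp_mul (hs a (Multiset.mem_cons_self a s))
      (Multiset.prod_ne_zero fun h => hs' 0 h rfl), ih hs', Multiset.map_cons, Multiset.sum_cons]

/-- A root of a nonzero polynomial with algebraic coefficients is algebraic. -/
theorem Polynomial.isAlgebraic_of_isRoot {F K : Type*} [Field F] [Field K] [Algebra F K]
    {P : K[X]} (hP : P ≠ 0) (hPalg : ∀ i, IsAlgebraic F (P.coeff i)) {α : K} (hα : P.IsRoot α) :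
    IsAlgebraic F α := by
  obtain ⟨Q, rfl⟩ : ∃ Q : (algebraicClosure F K)[X], Q.map (algebraMap _ K) = P := by
    refine (mem_lifts P).1 ((lifts_iff_coeff_lifts P).2 fun i => ?_)
    exact ⟨⟨P.coeff i, mem_algebraicClosure_iff.2 (hPalg i)⟩, rfl⟩
  have h : IsAlgebraic (algebraicClosure F K) α :=
    ⟨Q, fun h => hP (by rw [h, Polynomial.map_zero]), by rwa [IsRoot, eval_map_algebraMap] at hα⟩
  exact h.restrictScalars F

/-- For a nonzero polynomial `P` over `ℂ_p` with algebraic coefficients, the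
averages `(1/N) ∑_{i=m}^N ord_p(P(i))` converge (to a finite limit) for a
suitable starting index `m`. -/
theorem average_ordp_polynomial_converges (p : ℕ) [Fact p.Prime] (K : Type*)
    [NontriviallyNormedField K] [Algebra ℚ_[p] K] [IsPadicComplex p K] [CharZero K]
    (P : Polynomial K) (hP : P ≠ 0) (hPalg : ∀ i, IsAlgebraic ℚ (P.coeff i)) :
    ∃ (m : ℕ) (L : ℝ), (∀ i : ℕ, m ≤ i → P.eval (i : K) ≠ 0) ∧
      Filter.Tendsto
        (fun N : ℕ => (1 / (N : ℝ)) * ∑ i ∈ Finset.Icc m N, ordp p (P.eval (i : K)))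
        Filter.atTop (nhds L) := by
  have : IsAlgClosed K := IsPadicComplex.isAlgClosed (p := p)
  obtain ⟨m, hm⟩ : ∃ m : ℕ, ∀ i : ℕ, m ≤ i → P.eval (i : K) ≠ 0 := by
    have hfin : {i : ℕ | P.eval (i : K) = 0}.Finite :=
      (finite_setOfPred_isRoot hP).preimage Nat.cast_injective.injOn
    obtain ⟨b, hb⟩ := hfin.bddAbove
    exact ⟨b + 1, fun i hi h => by have := hb h; omega⟩
  have hne : ∀ α ∈ P.roots, ∀ i : ℕ, ((m + i : ℕ) : K) - α ≠ 0 := fun α hα i h =>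
    hm (m + i) (Nat.le_add_right m i) (by rw [sub_eq_zero.1 h]; exact isRoot_of_mem_roots hα)
  have hfactor : ∀ i : ℕ, ordp p (P.eval ((m + i : ℕ) : K)) = ordp p P.leadingCoeff
      + (P.roots.map fun α => ordp p (((m + i : ℕ) : K) - α)).sum := by
    intro i
    have hmem : ∀ x ∈ P.roots.map (fun α => ((m + i : ℕ) : K) - α), x ≠ 0 := fun x hx => by
      obtain ⟨α, hα, rfl⟩ := Multiset.mem_map.1 hx
      exact hne α hα i
    rw [(IsAlgClosed.splits P).eval_eq_prod_roots, ordp_mul (leadingCoeff_ne_zero.2 hP)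
      (Multiset.prod_ne_zero fun h => hmem 0 h rfl), ordp_multiset_prod hmem, Multiset.map_map]
    rfl
  obtain ⟨L, hL⟩ := exists_hasAverage_multiset_sum P.roots
    (fun α i => ordp p (((m + i : ℕ) : K) - α)) fun α hα => by
      have halg : IsAlgebraic ℚ (α - m) :=
        (P.isAlgebraic_of_isRoot hP hPalg (isRoot_of_mem_roots hα)).sub (isAlgebraic_natCast m)
      have heq : ∀ i : ℕ, ((m + i : ℕ) : K) - α = (i : K) - (α - m) := fun i => by
        push_cast
        ring
      simp only [heq]
      refine exists_hasAverage_ordp_natCast_sub halg fun i => sub_ne_zero.1 ?_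
      rw [← heq]
      exact hne α hα i
  refine ⟨m, ordp p P.leadingCoeff + L, hm,
    HasAverage.tendsto_sum_Icc (u := fun i => ordp p (P.eval (i : K))) ?_⟩
  simp only [hfactor]
  exact (HasAverage.const _).add hL
end

section
/- Let p be a prime, let A, B, h be polynomials over ℂ_p with h not identically zero, and let f, g : ℂ_p → ℂ_p be entire functions satisfying, for all x ∈ ℂ_p, A'(x)·f(x) + 2·A(x)·f'(x) = h(x)·g(x) and B'(x)·g(x) + 2·B(x)·g'(x) = −h(x)·f(x). Then f satisfies the second-order linear differential equation: for all x ∈ ℂ_p, 4·A(x)·B(x)·h(x)·f''(x) + (6·A'(x)·B(x)·h(x) + 2·A(x)·B'(x)·h(x) − 4·A(x)·B(x)·h'(x))·f'(x) + (A'(x)·B'(x)·h(x) + 2·A''(x)·B(x)·h(x) − 2·B(x)·A'(x)·h'(x) + h(x)³)·f(x) = 0. -/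
/-- If entire `f, g` on `ℂ_p` satisfy `A' f + 2 A f' = h g` and
`B' g + 2 B g' = -h f` with `h ≠ 0`, then `f` satisfies the second-order linear
ODE `4ABh f'' + (6A'Bh + 2AB'h - 4ABh') f' + (A'B'h + 2A''Bh - 2BA'h' + h³) f = 0`. -/
theorem second_order_ode_for_f (p : ℕ) [Fact p.Prime] (K : Type*)
    [NontriviallyNormedField K] [Algebra ℚ_[p] K] [IsPadicComplex p K]
    (A B h : Polynomial K) (hh : h ≠ 0)
    (f g : K → K) (hf : ∀ x, AnalyticAt K f x) (hg : ∀ x, AnalyticAt K g x)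
    (heq1 : ∀ x, (Polynomial.derivative A).eval x * f x + 2 * A.eval x * deriv f x
        = h.eval x * g x)
    (heq2 : ∀ x, (Polynomial.derivative B).eval x * g x + 2 * B.eval x * deriv g x
        = -(h.eval x) * f x) :
    ∀ x, 4 * A.eval x * B.eval x * h.eval x * deriv (deriv f) x
        + (6 * (Polynomial.derivative A).eval x * B.eval x * h.eval x
            + 2 * A.eval x * (Polynomial.derivative B).eval x * h.eval x
            - 4 * A.eval x * B.eval x * (Polynomial.derivative h).eval x) * deriv f x
        + ((Polynomial.derivative A).eval x * (Polynomial.derivative B).eval x * h.eval x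
            + 2 * (Polynomial.derivative (Polynomial.derivative A)).eval x
                * B.eval x * h.eval x
            - 2 * B.eval x * (Polynomial.derivative A).eval x
                * (Polynomial.derivative h).eval x
            + (h.eval x) ^ 3) * f x
        = 0 := by
  intro x
  have : CompleteSpace K := IsPadicComplex.complete p
  have hf0 := (hf x).differentiableAt.hasDerivAt
  have hf1 := (hf x).deriv.differentiableAt.hasDerivAt
  have hg0 := (hg x).differentiableAt.hasDerivAt
  have hlhs := ((A.derivative.hasDerivAt x).mul hf0).add
    (((A.hasDerivAt x).const_mul 2).mul hf1)
  have hrhs := (h.hasDerivAt x).mul hg0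
  have hderiv := hlhs.unique (hrhs.congr_of_eventuallyEq (Filter.Eventually.of_forall heq1))
  linear_combination 2 * B.eval x * h.eval x * hderiv
    + (h.eval x * B.derivative.eval x - 2 * B.eval x * h.derivative.eval x) * heq1 x
    + h.eval x ^ 2 * heq2 x
end

section
/- Let p be a prime, let A, B be nonzero polynomials over ℂ_p all of whose coefficients are algebraic over ℚ, and let f, g : ℂ_p → ℂ_p be entire functions satisfying A(x)·f(x)² + B(x)·g(x)² = 1 for all x and g(0) ≠ 0. Let h be a nonzero polynomial over ℂ_p of degree μ such that for all x ∈ ℂ_p, A'(x)·f(x) + 2·A(x)·f'(x) = h(x)·g(x) and B'(x)·g(x) + 2·B(x)·g'(x) = −h(x)·f(x). If the iterated derivative f⁽ⁱ⁾(0) is algebraic over ℚ for every i ≤ μ + 1 and g⁽ⁱ⁾(0) is algebraic over ℚ for every i ≤ μ, then the leading coefficient of h is algebraic over ℚ. -/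
theorem Polynomial.iteratedDeriv_eval {𝕜 : Type*} [NontriviallyNormedField 𝕜]
    (P : Polynomial 𝕜) (n : ℕ) :
    iteratedDeriv n (fun x => P.eval x) = fun x => (Polynomial.derivative^[n] P).eval x := by
  induction n with
  | zero => simp
  | succ n ih =>
    ext x
    rw [iteratedDeriv_succ, ih, Function.iterate_succ_apply', Polynomial.deriv]

theorem Polynomial.iteratedDeriv_eval_zero {𝕜 : Type*} [NontriviallyNormedField 𝕜]
    (P : Polynomial 𝕜) (n : ℕ) :
    iteratedDeriv n (fun x => P.eval x) 0 = n.factorial * P.coeff n := by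
  rw [P.iteratedDeriv_eval]
  beta_reduce
  rw [← Polynomial.coeff_zero_eq_eval_zero,
    Polynomial.coeff_iterate_derivative]
  simp [Nat.descFactorial_self]

section SubfieldTaylor

variable {𝕜 : Type*} [NontriviallyNormedField 𝕜] {S : Subfield 𝕜} {F G : 𝕜 → 𝕜} {a : 𝕜}

/-- If the Taylor data of two functions up to order `n` lie in a subfield, so does the `n`-th
derivative of their product. -/
theorem iteratedDeriv_fun_mul_mem {n : ℕ} (hF : ContDiffAt 𝕜 n F a) (hG : ContDiffAt 𝕜 n G a)
    (hFS : ∀ i ≤ n, iteratedDeriv i F a ∈ S) (hGS : ∀ i ≤ n, iteratedDeriv i G a ∈ S) :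
    iteratedDeriv n (fun x => F x * G x) a ∈ S := by
  rw [iteratedDeriv_fun_mul hF hG]
  refine sum_mem fun i hi => mul_mem (mul_mem (natCast_mem S _) (hFS i ?_)) (hGS _ (n.sub_le i))
  exact Nat.lt_succ_iff.mp (Finset.mem_range.mp hi)

/-- If the Taylor data of `F * G` and of `G` up to order `n` lie in a subfield and `G a ≠ 0`,
then so do the Taylor data of `F` up to order `n`. -/
theorem iteratedDeriv_mem_of_fun_mul_mem {n : ℕ} (hF : ContDiffAt 𝕜 n F a)
    (hG : ContDiffAt 𝕜 n G a) (hGa : G a ≠ 0)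
    (hFG : ∀ i ≤ n, iteratedDeriv i (fun x => F x * G x) a ∈ S)
    (hGS : ∀ i ≤ n, iteratedDeriv i G a ∈ S) :
    ∀ i ≤ n, iteratedDeriv i F a ∈ S := by
  intro i
  induction i using Nat.strong_induction_on with
  | _ i ih =>
    intro hi
    have hin : ((i : ℕ∞) : WithTop ℕ∞) ≤ n := by exact_mod_cast hi
    have hmul := iteratedDeriv_fun_mul (n := i) (hF.of_le hin) (hG.of_le hin)
    rw [Finset.sum_range_succ] at hmul
    simp only [Nat.choose_self, Nat.cast_one, one_mul, Nat.sub_self, iteratedDeriv_zero] at hmul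
    rw [← sub_eq_iff_eq_add'] at hmul
    rw [eq_div_of_mul_eq hGa hmul.symm]
    refine div_mem (sub_mem (hFG i hi) (sum_mem fun j hj => ?_)) (hGS 0 (Nat.zero_le n))
    have hji := Finset.mem_range.mp hj
    exact mul_mem (mul_mem (natCast_mem S _) (ih j hji (hji.le.trans hi)))
      (hGS _ ((i.sub_le j).trans hi))

end SubfieldTaylor

/-- Under the hypotheses of the main theorem with `h ≠ 0` of degree `μ`, the
leading coefficient of `h` is algebraic over `ℚ`. -/
theorem leadingCoeff_h_algebraic (p : ℕ) [Fact p.Prime] (K : Type*)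
    [NontriviallyNormedField K] [Algebra ℚ_[p] K] [IsPadicComplex p K] [CharZero K]
    (A B : Polynomial K) (hA : A ≠ 0) (hB : B ≠ 0)
    (hAalg : ∀ i, IsAlgebraic ℚ (A.coeff i)) (hBalg : ∀ i, IsAlgebraic ℚ (B.coeff i))
    (f g : K → K) (hf : ∀ x, AnalyticAt K f x) (hg : ∀ x, AnalyticAt K g x)
    (heq : ∀ x, A.eval x * (f x) ^ 2 + B.eval x * (g x) ^ 2 = 1)
    (hg0 : g 0 ≠ 0)
    (h : Polynomial K) (hh : h ≠ 0) (μ : ℕ) (hμ : h.natDegree = μ)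
    (heq1 : ∀ x, (Polynomial.derivative A).eval x * f x + 2 * A.eval x * deriv f x
        = h.eval x * g x)
    (heq2 : ∀ x, (Polynomial.derivative B).eval x * g x + 2 * B.eval x * deriv g x
        = -(h.eval x) * f x)
    (hfalg : ∀ i : ℕ, i ≤ μ + 1 → IsAlgebraic ℚ (iteratedDeriv i f 0))
    (hgalg : ∀ i : ℕ, i ≤ μ → IsAlgebraic ℚ (iteratedDeriv i g 0)) :
    IsAlgebraic ℚ h.leadingCoeff := by
  have := IsPadicComplex.complete p (K := K)
  let S : Subfield K := (algebraicClosure ℚ K).toSubfield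
  have mem_S (x : K) : x ∈ S ↔ IsAlgebraic ℚ x := mem_algebraicClosure_iff
  have smooth_poly (P : Polynomial K) (n : ℕ) : ContDiffAt K n (fun x => P.eval x) 0 :=
    (P.contDiff_aeval n).contDiffAt
  have poly_mem {P : Polynomial K} (hP : ∀ i, P.coeff i ∈ S) (i : ℕ) :
      iteratedDeriv i (fun x => P.eval x) 0 ∈ S := by
    rw [P.iteratedDeriv_eval_zero]
    exact mul_mem (natCast_mem S _) (hP i)
  have hAS (i : ℕ) : A.coeff i ∈ S := (mem_S _).mpr (hAalg i)
  have hA'S (i : ℕ) : (Polynomial.derivative A).coeff i ∈ S := by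
    rw [Polynomial.coeff_derivative]
    exact mul_mem (hAS _) (add_mem (natCast_mem S i) (one_mem S))
  have h2AS (i : ℕ) : (2 * A).coeff i ∈ S := by
    rw [Polynomial.coeff_ofNat_mul]
    exact mul_mem (ofNat_mem S 2) (hAS i)
  have hprod : (fun x => h.eval x * g x) = fun x =>
      (Polynomial.derivative A).eval x * f x + (2 * A).eval x * deriv f x := by
    funext x
    rw [← heq1 x]
    simp
  have hprod_mem (n : ℕ) (hn : n ≤ μ) : iteratedDeriv n (fun x => h.eval x * g x) 0 ∈ S := by
    have hfn : ContDiffAt K n f 0 := (hf 0).contDiffAt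
    have hf'n : ContDiffAt K n (deriv f) 0 := (hf 0).deriv.contDiffAt
    rw [hprod, iteratedDeriv_fun_add ((smooth_poly _ n).mul hfn) ((smooth_poly _ n).mul hf'n)]
    refine add_mem
      (iteratedDeriv_fun_mul_mem (smooth_poly _ n) hfn (fun i _ => poly_mem hA'S i)
        fun i hi => (mem_S _).mpr (hfalg i (by lia)))
      (iteratedDeriv_fun_mul_mem (smooth_poly _ n) hf'n (fun i _ => poly_mem h2AS i)
        fun i hi => ?_)
    rw [← iteratedDeriv_succ', mem_S]
    exact hfalg (i + 1) (by lia)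
  have htop := iteratedDeriv_mem_of_fun_mul_mem (smooth_poly h μ) (hg 0).contDiffAt hg0 hprod_mem
    (fun i hi => (mem_S _).mpr (hgalg i hi)) μ le_rfl
  rw [h.iteratedDeriv_eval_zero] at htop
  have hfact : (μ.factorial : K) ≠ 0 := Nat.cast_ne_zero.mpr μ.factorial_ne_zero
  rw [Polynomial.leadingCoeff, hμ, ← mem_S, ← mul_div_cancel_left₀ (h.coeff μ) hfact]
  exact div_mem htop (natCast_mem S _)
end

section
/- Let p be a prime, α a p-adic integer (α ∈ ℤ_p), and N a natural number. Then ‖∏_{j=0}^{N} (α − j)‖ ≤ ‖(N+1)!‖, where the product is taken in ℤ_p, (N+1)! is the factorial viewed in ℤ_p, and ‖·‖ is the p-adic norm. Equivalently, (N+1)! divides the falling factorial α(α−1)⋯(α−N) in ℤ_p. -/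
/-- For a `p`-adic integer `α`, the falling factorial `α(α-1)⋯(α-N)` has `p`-adic
norm at most that of `(N+1)!`; equivalently `(N+1)!` divides it in `ℤ_p`. -/
theorem norm_falling_factorial_le (p : ℕ) [Fact p.Prime] (α : ℤ_[p]) (N : ℕ) :
    ‖∏ j ∈ Finset.range (N + 1), (α - (j : ℤ_[p]))‖ ≤ ‖((N + 1).factorial : ℤ_[p])‖ := by
  have h := Ring.descPochhammer_eq_factorial_smul_choose α (N + 1)
  rw [← Polynomial.aeval_eq_smeval, Polynomial.aeval_def, ← Polynomial.eval_map,
    descPochhammer_map, descPochhammer_eval_eq_prod_range, nsmul_eq_mul] at h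
  rw [h, norm_mul]
  exact mul_le_of_le_one_right (norm_nonneg _) (PadicInt.norm_le_one _)
end

section
/- Let K be a field of characteristic zero, n a natural number, and α ∈ K an element with α ≠ j (image of the natural number j in K) for every j with 0 ≤ j ≤ n. Then (−1)^{n+1} / ∏_{j=0}^{n} (α − j) = Σ_{j=0}^{n} (−1)^{j+1} / ((n−j)! · j! · (α − j)), where the factorials are viewed as elements of K. -/
/-- The alternating sum of the reciprocals of `(n - j)! * j!` vanishes for positive `n`. -/
theorem sum_neg_one_pow_div_factorial_mul_factorial (K : Type*) [Field K] [CharZero K]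
    {n : ℕ} (hn : n ≠ 0) :
    ∑ j ∈ Finset.range (n + 1),
      (-1 : K) ^ (j + 1) / (((n - j).factorial : K) * (j.factorial : K)) = 0 := by
  have h : ∑ j ∈ Finset.range (n + 1), (-1 : K) ^ j * (n.choose j : K) = 0 := by
    exact_mod_cast congrArg (Int.cast : ℤ → K) (Int.alternating_sum_range_choose_of_ne hn)
  calc
    _ = ∑ j ∈ Finset.range (n + 1),
        -(n.factorial : K)⁻¹ * ((-1 : K) ^ j * (n.choose j : K)) := by
      refine Finset.sum_congr rfl fun j hj => ?_
      have hfac : (n.factorial : K) ≠ 0 := Nat.cast_ne_zero.2 n.factorial_ne_zero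
      rw [Nat.cast_choose K (Finset.mem_range_succ_iff.1 hj)]
      field_simp
      ring
    _ = 0 := by rw [← Finset.mul_sum, h, mul_zero]

/-- Partial fraction decomposition of the reciprocal falling factorial in a field
of characteristic zero. -/
theorem partial_fraction_falling_factorial (K : Type*) [Field K] [CharZero K]
    (n : ℕ) (α : K) (hα : ∀ j : ℕ, j ≤ n → α ≠ (j : K)) :
    (-1 : K) ^ (n + 1) / ∏ j ∈ Finset.range (n + 1), (α - (j : K)) =
      ∑ j ∈ Finset.range (n + 1),
        (-1 : K) ^ (j + 1) /
          (((n - j).factorial : K) * (j.factorial : K) * (α - (j : K))) := by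
  induction n with
  | zero => simp
  | succ n ih =>
    have hne : α - ((n + 1 : ℕ) : K) ≠ 0 := sub_ne_zero.2 (hα _ le_rfl)
    rw [Finset.prod_range_succ, ← div_div, pow_succ, mul_neg_one, neg_div,
      ih fun j hj => hα j (hj.trans n.le_succ), div_eq_iff hne, neg_eq_iff_add_eq_zero,
      ← sum_neg_one_pow_div_factorial_mul_factorial K n.succ_ne_zero, Finset.sum_mul,
      Finset.sum_range_succ _ (n + 1), Finset.sum_range_succ _ (n + 1), ← add_assoc,
      ← Finset.sum_add_distrib]
    congr 1
    · refine Finset.sum_congr rfl fun j hj => ?_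
      have hj : j ≤ n := Finset.mem_range_succ_iff.1 hj
      have hαj : α - (j : K) ≠ 0 := sub_ne_zero.2 (hα j (hj.trans n.le_succ))
      obtain ⟨k, rfl⟩ := Nat.exists_eq_add_of_le hj
      have hk : (k.factorial : K) ≠ 0 := Nat.cast_ne_zero.2 k.factorial_ne_zero
      have hjf : (j.factorial : K) ≠ 0 := Nat.cast_ne_zero.2 j.factorial_ne_zero
      have hk1 : (k : K) + 1 ≠ 0 := Nat.cast_add_one_ne_zero k
      rw [Nat.succ_eq_add_one, show j + k + 1 - j = k + 1 by omega, Nat.add_sub_cancel_left,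
        Nat.factorial_succ]
      push_cast
      field_simp
      ring
    · rw [← div_div, div_mul_cancel₀ _ hne]
end
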